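/- For a k-th order Lagrangian L and every r with 0 ≤ r ≤ k−1, the partial Jacobian matrix of the Ostrogradskii momentum p̂^r with respect to its highest-order argument q_{2k−1−r} equals (−1)^{k−1−r} W(q₀,…,q_k) at every point (q₀,…,q_{2k−1−r}). -/

import Mathlib

open scoped BigOperators

noncomputable section

/-- `Vec n` is `ℝⁿ`. -/
abbrev Vec (n : ℕ) := Fin n → ℝ

/-- `Jet n m` packages the variables `q₀, …, q_m`, each a vector of `ℝⁿ`. -/
abbrev Jet (n m : ℕ) := Fin (m+1) → Vec n

/-- The standard inner product on `ℝⁿ`. -/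
def dot {n : ℕ} (u v : Vec n) : ℝ := ∑ a, u a * v a

/-- Forget the top variable `q_{m+1}`. -/
def res {n m : ℕ} (q : Jet n (m+1)) : Jet n m := fun i => q i.castSucc

/-- The shift `(shft q) i = q (i+1)`. -/
def shft {n m : ℕ} (q : Jet n (m+1)) : Jet n m := fun i => q i.succ

/-- Restriction of a jet to a lower-order jet. -/
def trunc {n m m' : ℕ} (h : m' ≤ m) (q : Jet n m) : Jet n m' :=
  fun i => q (Fin.castLE (Nat.succ_le_succ h) i)

/-- The partial gradient of `f` in the slot `q_i`, identified with a vector of `ℝⁿ`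
via the standard inner product (i.e. the vector representing the partial
differential `∂f/∂q_i`). -/
def gradSlot {n m : ℕ} (f : Jet n m → ℝ) (q : Jet n m) (i : Fin (m+1)) : Vec n :=
  fun a => fderiv ℝ f q (Pi.single i (Pi.single a 1))

/-- The formal total time derivative of a time-independent function
`f(q₀,…,q_m)`: `D_t f = Σ_i (∂f/∂q_i)·q_{i+1}`, a function of `(q₀,…,q_{m+1})`. -/
def Dt0 {n m : ℕ} {F : Type*} [NormedAddCommGroup F] [NormedSpace ℝ F]
    (f : Jet n m → F) (q : Jet n (m+1)) : F :=
  fderiv ℝ f (res q) (shft q)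

/-- Iterated formal total time derivative (time-independent functions). -/
def DtIter0 {n m : ℕ} {F : Type*} [NormedAddCommGroup F] [NormedSpace ℝ F] :
    (r : ℕ) → (Jet n m → F) → (Jet n (m + r) → F)
  | 0, f => f
  | r+1, f => Dt0 (DtIter0 r f)

/-- The formal total time derivative of a time-dependent function
`f(t,q₀,…,q_m)`: `D_t f = ∂f/∂t + Σ_i (∂f/∂q_i)·q_{i+1}`. -/
def Dt {n m : ℕ} {F : Type*} [NormedAddCommGroup F] [NormedSpace ℝ F]
    (f : ℝ × Jet n m → F) (x : ℝ × Jet n (m+1)) : F :=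
  fderiv ℝ f (x.1, res x.2) (1, shft x.2)

/-- Iterated formal total time derivative (time-dependent functions). -/
def DtIter {n m : ℕ} {F : Type*} [NormedAddCommGroup F] [NormedSpace ℝ F] :
    (r : ℕ) → (ℝ × Jet n m → F) → (ℝ × Jet n (m + r) → F)
  | 0, f => f
  | r+1, f => Dt (DtIter r f)

/-- The partial gradient in the slot `q_i` of a time-dependent function. -/
def gradSlotT {n m : ℕ} (f : ℝ × Jet n m → ℝ) (x : ℝ × Jet n m) (i : Fin (m+1)) : Vec n :=
  fun a => fderiv ℝ f x (0, Pi.single i (Pi.single a 1))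

/-- The Ostrogradskii momenta of a Lagrangian `L(q₀,…,q_{k+1})` of order `k+1`:
`mom L j` is the momentum `p̂^{k-j}`, a function of `(q₀,…,q_{k+j+1})`.
It is defined by the downward recursion `p̂^{k} = ∂L/∂q_{k+1}` and
`p̂^{i-1} = ∂L/∂q_i − D_t p̂^i`. -/
def mom {n k : ℕ} (L : Jet n (k+1) → ℝ) : (j : ℕ) → (Jet n (k + j + 1) → Vec n)
  | 0 => fun q => gradSlot L q (Fin.last (k+1))
  | j+1 => fun q =>
      gradSlot L (trunc (by omega) q) ⟨k - j, by omega⟩ - Dt0 (mom L j) q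

/-- The Euler–Lagrange expression `[L] = Σ_{r=0}^{k+1} (−1)^r D_t^r (∂L/∂q_r)`
of a Lagrangian of order `k+1`, a function of `(q₀,…,q_{2(k+1)})`. -/
def EL {n k : ℕ} (L : Jet n (k+1) → ℝ) (q : Jet n (k+k+2)) : Vec n :=
  ∑ r : Fin (k+2),
    ((-1 : ℝ)) ^ (r : ℕ) •
      DtIter0 (r : ℕ) (fun q' => gradSlot L q' r)
        (trunc (by have := r.isLt; omega) q)

/-- The Hessian `W = ∂²L/∂q_{k+1}∂q_{k+1}` of a Lagrangian of order `k+1`,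
as an operator `ℝⁿ → ℝⁿ` (a function of `(q₀,…,q_{k+1})`). -/
def hessOp {n k : ℕ} (L : Jet n (k+1) → ℝ) (q : Jet n (k+1)) (v : Vec n) : Vec n :=
  fun a => fderiv ℝ (fun q' => gradSlot L q' (Fin.last (k+1)) a) q
    (Pi.single (Fin.last (k+1)) v)

/-- The first partial Legendre–Ostrogradskii transformation
`F₀ : (q₀,…,q_{2k+1}) ↦ (q₀,…,q_{2k}; p̂⁰)`. -/
def F0 {n k : ℕ} (L : Jet n (k+1) → ℝ) (q : Jet n (k+k+1)) : Jet n (k+k) × Vec n :=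
  (res q, mom L k q)

/-- Pull-back through `F₀` of a (time-dependent) function on the intermediate
space `P₁`. -/
def pullF0 {n k : ℕ} {F : Type*} (L : Jet n (k+1) → ℝ)
    (g : ℝ × (Jet n (k+k) × Vec n) → F) (x : ℝ × Jet n (k+k+1)) : F :=
  g (x.1, F0 L x.2)

/-- The intermediate evolution operator `K₀`:
`K₀·g = (∂g/∂t)∘F₀ + Σ_{i=0}^{2k} ((∂g/∂q_i)∘F₀)·q_{i+1} + ((∂g/∂p⁰)∘F₀)·(∂L/∂q₀)`. -/
def K0 {n k : ℕ} {F : Type*} [NormedAddCommGroup F] [NormedSpace ℝ F]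
    (L : Jet n (k+1) → ℝ)
    (g : ℝ × (Jet n (k+k) × Vec n) → F) (x : ℝ × Jet n (k+k+1)) : F :=
  fderiv ℝ g (x.1, F0 L x.2)
    (1, shft x.2, gradSlot L (trunc (by omega) x.2) 0)

/-- The partial gradient `∂g/∂p⁰` of a function on `P₁`, as a vector of `ℝⁿ`. -/
def gradMom {n k : ℕ} (g : ℝ × (Jet n (k+k) × Vec n) → ℝ)
    (x : ℝ × (Jet n (k+k) × Vec n)) : Vec n :=
  fun a => fderiv ℝ g x (0, 0, Pi.single a 1)

theorem contDiff_res {n m : ℕ} : ContDiff ℝ (⊤ : ℕ∞) (res : Jet n (m+1) → Jet n m) :=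
  contDiff_pi.2 fun i => contDiff_apply ℝ (Vec n) i.castSucc

theorem contDiff_shft {n m : ℕ} : ContDiff ℝ (⊤ : ℕ∞) (shft : Jet n (m+1) → Jet n m) :=
  contDiff_pi.2 fun i => contDiff_apply ℝ (Vec n) i.succ

theorem contDiff_trunc {n m m' : ℕ} (h : m' ≤ m) :
    ContDiff ℝ (⊤ : ℕ∞) (trunc h : Jet n m → Jet n m') :=
  contDiff_pi.2 fun i => contDiff_apply ℝ (Vec n) (Fin.castLE (Nat.succ_le_succ h) i)

theorem contDiff_fderiv_top {E F : Type*} [NormedAddCommGroup E] [NormedSpace ℝ E]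
    [NormedAddCommGroup F] [NormedSpace ℝ F] {f : E → F} (hf : ContDiff ℝ (⊤ : ℕ∞) f) :
    ContDiff ℝ (⊤ : ℕ∞) (fderiv ℝ f) :=
  hf.fderiv_right (by simp)

theorem contDiff_gradSlot {n m : ℕ} {f : Jet n m → ℝ} (hf : ContDiff ℝ (⊤ : ℕ∞) f)
    (i : Fin (m+1)) : ContDiff ℝ (⊤ : ℕ∞) (fun q => gradSlot f q i) :=
  contDiff_pi.2 fun _ => (contDiff_fderiv_top hf).clm_apply contDiff_const

theorem contDiff_Dt0 {n m : ℕ} {F : Type*} [NormedAddCommGroup F] [NormedSpace ℝ F]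
    {f : Jet n m → F} (hf : ContDiff ℝ (⊤ : ℕ∞) f) : ContDiff ℝ (⊤ : ℕ∞) (Dt0 f) :=
  ((contDiff_fderiv_top hf).comp contDiff_res).clm_apply contDiff_shft

theorem contDiff_mom {n k : ℕ} {L : Jet n (k+1) → ℝ} (hL : ContDiff ℝ (⊤ : ℕ∞) L) (j : ℕ) :
    ContDiff ℝ (⊤ : ℕ∞) (mom L j) := by
  induction j with
  | zero => exact contDiff_gradSlot hL _
  | succ j ih =>
    exact ((contDiff_gradSlot hL ⟨k - j, by omega⟩).comp
      (contDiff_trunc (by omega))).sub (contDiff_Dt0 ih)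

theorem res_add_smul_single_last {n m : ℕ} (q : Jet n (m+1)) (t : ℝ) (v : Vec n) :
    res (q + t • (Pi.single (Fin.last (m+1)) v : Jet n (m+1))) = res q := by
  funext i
  simp [res, (Fin.castSucc_lt_last i).ne]

theorem shft_add_smul_single_last {n m : ℕ} (q : Jet n (m+1)) (t : ℝ) (v : Vec n) :
    shft (q + t • (Pi.single (Fin.last (m+1)) v : Jet n (m+1))) =
      shft q + t • (Pi.single (Fin.last m) v : Jet n m) := by
  funext i
  by_cases hi : i = Fin.last m
  · subst hi
    simp [shft]
  · have : i.succ ≠ Fin.last (m+1) := by rwa [Ne, ← Fin.succ_last, Fin.succ_inj]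
    simp [shft, hi, this]

theorem trunc_add_smul_single_last {n m m' : ℕ} (h : m' ≤ m + 1) (h' : m' < m + 1)
    (q : Jet n (m+1)) (t : ℝ) (v : Vec n) :
    trunc h (q + t • (Pi.single (Fin.last (m+1)) v : Jet n (m+1))) = trunc h q := by
  funext i
  have : Fin.castLE (Nat.succ_le_succ h) i ≠ Fin.last (m+1) := by
    intro hi
    have := congrArg Fin.val hi
    simp at this
    omega
  simp [trunc, this]

/-- A function which is affine along the line through `x` in the direction `w` has directional
derivative equal to the slope. -/
theorem fderiv_apply_of_affine_along {E F : Type*} [NormedAddCommGroup E] [NormedSpace ℝ E]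
    [NormedAddCommGroup F] [NormedSpace ℝ F] {f : E → F} {x w : E} {c : F}
    (hf : DifferentiableAt ℝ f x) (h : ∀ t : ℝ, f (x + t • w) = f x + t • c) :
    fderiv ℝ f x w = c := by
  rw [← hf.lineDeriv_eq_fderiv, lineDeriv]
  simp only [h]
  have := ((hasDerivAt_id (0 : ℝ)).smul_const c).const_add (f x)
  simpa using this.deriv

theorem fderiv_mom_succ_single_last {n k : ℕ} {L : Jet n (k+1) → ℝ}
    (hL : ContDiff ℝ (⊤ : ℕ∞) L) (j : ℕ) (q : Jet n (k + (j + 1) + 1)) (v : Vec n) :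
    fderiv ℝ (mom L (j + 1)) q (Pi.single (Fin.last (k + (j + 1) + 1)) v) =
      -fderiv ℝ (mom L j) (res q) (Pi.single (Fin.last (k + j + 1)) v) := by
  refine fderiv_apply_of_affine_along ((contDiff_mom hL _).differentiable (by simp) q) fun t => ?_
  have h₁ : k + 1 ≤ k + (j + 1) + 1 := by omega
  have h₂ : k + 1 < k + (j + 1) + 1 := by omega
  have htrunc := trunc_add_smul_single_last h₁ h₂ q t v
  have hres := res_add_smul_single_last q t v
  have hshft := shft_add_smul_single_last q t v
  simp only [mom, Dt0]
  erw [htrunc, hres, hshft, map_add, map_smul]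
  rw [smul_neg]
  exact (sub_add_eq_sub_sub _ _ _).trans (sub_eq_add_neg _ _)

theorem fderiv_mom_single_last {n k : ℕ} {L : Jet n (k+1) → ℝ}
    (hL : ContDiff ℝ (⊤ : ℕ∞) L) (j : ℕ) (h : k + 1 ≤ k + j + 1) (q : Jet n (k + j + 1))
    (v : Vec n) :
    fderiv ℝ (mom L j) q (Pi.single (Fin.last (k + j + 1)) v) =
      (-1 : ℝ) ^ j • hessOp L (trunc h q) v := by
  induction j with
  | zero =>
    rw [pow_zero, one_smul]
    have hd : ∀ a, DifferentiableAt ℝ (fun q' => gradSlot L q' (Fin.last (k+1)) a) q := fun a =>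
      (contDiff_pi.1 (contDiff_gradSlot hL (Fin.last (k+1))) a).differentiable (by simp) q
    funext a
    exact congrArg (fun T => T (Pi.single (Fin.last (k+1)) v) a) (fderiv_pi hd)
  | succ j ih =>
    rw [fderiv_mom_succ_single_last hL, ih (by omega), pow_succ, mul_neg_one, neg_smul]
    rfl

/-- For `0 ≤ r ≤ k` (the order of the Lagrangian being `k+1`), the partial
Jacobian of the Ostrogradskii momentum `p̂^r = mom L (k−r)` with respect to its
highest-order argument `q_{2(k+1)−1−r}` equals `(−1)^{(k+1)−1−r} W` at every
point. -/
theorem momentum_top_jacobian_eq_hessian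
    (n k : ℕ) (hn : 1 ≤ n)
    (L : Jet n (k+1) → ℝ) (hL : ContDiff ℝ (⊤ : ℕ∞) L)
    (r : ℕ) (hr : r ≤ k) :
    ∀ (q : Jet n (k + (k - r) + 1)) (v : Vec n),
      fderiv ℝ (mom L (k - r)) q (Pi.single (Fin.last (k + (k - r) + 1)) v) =
        ((-1 : ℝ)) ^ (k - r) • hessOp L (trunc (by omega) q) v := by
  intro q v
  exact fderiv_mom_single_last hL (k - r) _ q v

end
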